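/- As ε → 0⁺, the functions τ ↦ ζ(1/2 − ε + iτ)/(ζ(1/2 + ε + iτ)·(1/2 − ε + iτ)) converge in L²(ℝ) to τ ↦ 1/(1/2 + iτ). -/

import Mathlib

open Filter MeasureTheory Complex

lemma aux_factor (A δ y : ℝ) (hA : 1/8 ≤ A) (h0 : 0 ≤ δ) (h1 : δ ≤ 1) :
    (((A+3/2)^2+9*y^2)/((A+1/2)^2+9*y^2))^δ * (A^2+y^2) ≤ (A+δ)^2+y^2 := by
  have hA0 : 0 < A := by linarith
  have hD : 0 < (A+1/2)^2+9*y^2 := by positivity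
  have hE : 0 < A^2+y^2 := by positivity
  have e1 : ((A+3/2)^2+9*y^2)/((A+1/2)^2+9*y^2) = 1 + (2*A+2)/((A+1/2)^2+9*y^2) := by
    field_simp; ring
  have hb : (1 + (2*A+2)/((A+1/2)^2+9*y^2))^δ ≤ 1 + δ * ((2*A+2)/((A+1/2)^2+9*y^2)) :=
    rpow_one_add_le_one_add_mul_self (by
      have : 0 ≤ (2*A+2)/((A+1/2)^2+9*y^2) := by positivity
      linarith) h0 h1
  have hc : (2*A+2)/((A+1/2)^2+9*y^2) ≤ 2*A/(A^2+y^2) := by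
    rw [div_le_div_iff₀ hD hE]
    nlinarith [mul_nonneg (sub_nonneg.2 hA) (sq_nonneg y)]
  rw [e1]
  calc _ ≤ (1 + δ * (2*A/(A^2+y^2))) * (A^2+y^2) := by
        gcongr
        exact hb.trans (by gcongr)
    _ = A^2+y^2+2*A*δ := by field_simp
    _ ≤ _ := by nlinarith [sq_nonneg δ]

lemma aux_prod (a δ y : ℝ) (ha : 1/8 ≤ a) (h0 : 0 ≤ δ) (h1 : δ ≤ 1) (n : ℕ) :
    ((a+n+1/2)^2+9*y^2)^δ * ∏ k ∈ Finset.range n, ((a+k)^2+y^2) ≤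
      ((a+1/2)^2+9*y^2)^δ * ∏ k ∈ Finset.range n, ((a+δ+k)^2+y^2) := by
  induction n with
  | zero => simp
  | succ n ih =>
    rw [Finset.prod_range_succ, Finset.prod_range_succ]
    have hn : (0:ℝ) ≤ n := n.cast_nonneg
    have hf := aux_factor (a+n) δ y (by linarith) h0 h1
    have hD : 0 < (a+n+1/2)^2+9*y^2 := by
      have : 0 < a + n + 1/2 := by linarith
      positivity
    rw [Real.div_rpow (by positivity) hD.le] at hf
    have hDp : 0 < ((a+n+1/2)^2+9*y^2)^δ := Real.rpow_pos_of_pos hD _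
    have e : (a + (n+1:ℕ) + 1/2) = a + n + 3/2 := by push_cast; ring
    rw [e]
    have hP : 0 ≤ ∏ k ∈ Finset.range n, ((a+k)^2+y^2) :=
      Finset.prod_nonneg fun _ _ => by positivity
    calc _ = (((a+n+1/2)^2+9*y^2)^δ * ∏ k ∈ Finset.range n, ((a+k)^2+y^2)) *
          (((a+n+3/2)^2+9*y^2)^δ / ((a+n+1/2)^2+9*y^2)^δ * ((a+n)^2+y^2)) := by
          field_simp
      _ ≤ (((a+1/2)^2+9*y^2)^δ * ∏ k ∈ Finset.range n, ((a+δ+k)^2+y^2)) *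
          ((a+n+δ)^2+y^2) := by
          apply mul_le_mul ih hf (by positivity)
          exact (mul_nonneg hDp.le hP).trans ih
      _ = _ := by
          rw [show a+n+δ = a+δ+n by ring]; ring

lemma aux_seq_norm (b y : ℝ) (n : ℕ) (hn : 0 < n) :
    ‖GammaSeq (b + I*y) n‖^2 = ((n:ℝ)^b * n.factorial)^2 /
      ∏ k ∈ Finset.range (n+1), ((b+k)^2+y^2) := by
  rw [GammaSeq, norm_div, norm_mul, norm_natCast_cpow_of_pos hn, norm_prod, div_pow,
    ← Finset.prod_pow]
  congr 1
  · simp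
  · refine Finset.prod_congr rfl fun k _ => ?_
    rw [← normSq_eq_norm_sq, normSq_apply]
    simp; ring

lemma aux_Gamma (a δ y : ℝ) (ha : 1/8 ≤ a) (h0 : 0 ≤ δ) (h1 : δ ≤ 1) :
    ‖Gamma ((a+δ:ℝ) + I*y)‖^2 ≤ ((a+1/2)^2+9*y^2)^δ * ‖Gamma (a + I*y)‖^2 := by
  refine le_of_tendsto_of_tendsto ((GammaSeq_tendsto_Gamma _).norm.pow 2)
    (((GammaSeq_tendsto_Gamma _).norm.pow 2).const_mul _) ?_
  filter_upwards [eventually_gt_atTop 0] with n hn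
  rw [aux_seq_norm _ _ _ hn, aux_seq_norm _ _ _ hn]
  have hp := aux_prod a δ y ha h0 h1 (n+1)
  have hn' : (0:ℝ) < n := by exact_mod_cast hn
  have P1 : 0 < ∏ k ∈ Finset.range (n+1), ((a+k)^2+y^2) :=
    Finset.prod_pos fun _ _ => by positivity
  have P2 : 0 < ∏ k ∈ Finset.range (n+1), ((a+δ+k)^2+y^2) :=
    Finset.prod_pos fun _ _ => by positivity
  rw [← mul_div_assoc, div_le_div_iff₀ P2 P1, Real.rpow_add hn']
  have hk : ((n:ℝ)^δ)^2 ≤ ((a+(n+1:ℕ)+1/2)^2+9*y^2)^δ := by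
    rw [← Real.rpow_natCast, ← Real.rpow_mul hn'.le, mul_comm, Real.rpow_mul hn'.le]
    apply Real.rpow_le_rpow (by positivity) _ h0
    push_cast
    rw [Real.rpow_two]
    nlinarith [sq_nonneg y]
  calc _ = ((n:ℝ)^a * n.factorial)^2 * (((n:ℝ)^δ)^2 * ∏ k ∈ Finset.range (n+1), ((a+k)^2+y^2)) := by
        ring
    _ ≤ ((n:ℝ)^a * n.factorial)^2 * (((a+1/2)^2+9*y^2)^δ *
          ∏ k ∈ Finset.range (n+1), ((a+δ+k)^2+y^2)) := by
        exact mul_le_mul_of_nonneg_left ((mul_le_mul_of_nonneg_right hk P1.le).trans hp)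
          (by positivity)
    _ = _ := by ring

lemma aux_GammaR (z : ℂ) : ‖Gammaℝ z‖ = Real.pi ^ (-z.re/2) * ‖Gamma (z/2)‖ := by
  rw [Gammaℝ_def, norm_mul, norm_cpow_eq_rpow_re_of_pos Real.pi_pos]
  simp

lemma aux_completed (z : ℂ) (hz : 0 < z.re) :
    completedRiemannZeta z = riemannZeta z * Gammaℝ z := by
  rw [riemannZeta_def_of_ne_zero (by rintro rfl; simp at hz),
    div_mul_cancel₀ _ (Gammaℝ_ne_zero_of_re_pos hz)]

lemma aux_zeta (ε τ : ℝ) (h0 : 0 < ε) (h1 : ε ≤ 1/4) :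
    ‖riemannZeta (1/2 - ε + I*τ)‖^2 ≤
      (1+9*τ^2)^(1/4:ℝ) * ‖riemannZeta (1/2 + ε + I*τ)‖^2 := by
  set w : ℂ := 1/2 - ε + I*τ with hw
  set s : ℂ := 1/2 + ε + I*τ with hs
  have hwr : w.re = 1/2 - ε := by simp [hw]
  have hsr : s.re = 1/2 + ε := by simp [hs]
  have hcs : 1 - w = (starRingEnd ℂ) s := by
    apply Complex.ext <;> simp [hw, hs]; ring
  have h := completedRiemannZeta_one_sub w
  rw [hcs, aux_completed w (by rw [hwr]; linarith), aux_completed _ (by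
    rw [conj_re, hsr]; linarith)] at h
  have hn := congrArg norm h
  have hc2 : (starRingEnd ℂ) s / 2 = (starRingEnd ℂ) (s/2) := by
    rw [map_div₀, map_ofNat]
  rw [norm_mul, norm_mul, riemannZeta_conj, norm_conj, aux_GammaR, aux_GammaR, hc2, Gamma_conj,
    norm_conj, conj_re, hsr, hwr] at hn
  have hG := aux_Gamma (1/4-ε/2) ε (τ/2) (by linarith) h0.le (by linarith)
  have e1 : (((1/4-ε/2)+ε : ℝ):ℂ) + I*((τ/2:ℝ):ℂ) = s/2 := by rw [hs]; push_cast; ring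
  have e2 : (((1/4-ε/2) : ℝ):ℂ) + I*((τ/2:ℝ):ℂ) = w/2 := by rw [hw]; push_cast; ring
  rw [e1, e2] at hG
  have hGw : 0 < ‖Gamma (w/2)‖ := norm_pos_iff.2 (Gamma_ne_zero_of_re_pos (by
    rw [← e2]; simp; linarith))
  have hK : ((1/4-ε/2+1/2)^2+9*(τ/2)^2)^ε ≤ (1+9*τ^2)^(1/4:ℝ) := by
    calc _ ≤ (1+9*τ^2)^ε := by
          apply Real.rpow_le_rpow (by positivity) _ h0.le
          nlinarith [sq_nonneg τ]
      _ ≤ _ := Real.rpow_le_rpow_of_exponent_le (by nlinarith [sq_nonneg τ]) h1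
  have hpi : Real.pi ^ (-(1/2+ε)/2) ≤ Real.pi ^ (-(1/2-ε)/2) :=
    Real.rpow_le_rpow_of_exponent_le (by linarith [Real.pi_gt_three]) (by linarith)
  have hp0 : 0 < Real.pi ^ (-(1/2-ε)/2) := Real.rpow_pos_of_pos Real.pi_pos _
  have hp1 : 0 < Real.pi ^ (-(1/2+ε)/2) := Real.rpow_pos_of_pos Real.pi_pos _
  generalize Real.pi ^ (-(1/2-ε)/2) = p at *
  generalize Real.pi ^ (-(1/2+ε)/2) = q at *
  have hle : ‖riemannZeta w‖ * ‖Gamma (w/2)‖ ≤ ‖riemannZeta s‖ * ‖Gamma (s/2)‖ := by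
    have : p * (‖riemannZeta w‖ * ‖Gamma (w/2)‖) ≤ p * (‖riemannZeta s‖ * ‖Gamma (s/2)‖) := by
      calc _ = q * (‖riemannZeta s‖ * ‖Gamma (s/2)‖) := by linarith
        _ ≤ _ := by gcongr
    exact le_of_mul_le_mul_left this hp0
  have h2 : ‖riemannZeta w‖^2 * ‖Gamma (w/2)‖^2 ≤
      ((1+9*τ^2)^(1/4:ℝ) * ‖riemannZeta s‖^2) * ‖Gamma (w/2)‖^2 := by
    calc _ = (‖riemannZeta w‖ * ‖Gamma (w/2)‖)^2 := by ring
      _ ≤ (‖riemannZeta s‖ * ‖Gamma (s/2)‖)^2 := by gcongr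
      _ = ‖riemannZeta s‖^2 * ‖Gamma (s/2)‖^2 := by ring
      _ ≤ ‖riemannZeta s‖^2 * ((1+9*τ^2)^(1/4:ℝ) * ‖Gamma (w/2)‖^2) := by
        gcongr
        exact hG.trans (by gcongr)
      _ = _ := by ring
  exact le_of_mul_le_mul_right h2 (by positivity)

lemma aux_ae : ∀ᵐ τ : ℝ, riemannZeta (1/2 + I*τ) ≠ 0 := by
  have hcount : riemannZetaZeros.Countable := by
    have := isDiscrete_iff_discreteTopology.mp isDiscrete_riemannZetaZeros
    exact TopologicalSpace.separableSpace_iff_countable.1 inferInstance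
  have hinj : Function.Injective (fun τ : ℝ => (1/2 + I*τ : ℂ)) := fun a b h => by
    simpa using h
  have := (hcount.preimage hinj).measure_zero volume
  rw [ae_iff]
  convert this using 2
  ext τ; simp [mem_riemannZetaZeros]

lemma aux_bound (ε τ : ℝ) (h0 : 0 < ε) (h1 : ε ≤ 1/4) :
    ‖riemannZeta (1/2 - ε + I*τ) /
            (riemannZeta (1/2 + ε + I*τ) * (1/2 - ε + I*τ)) -
          1 / (1/2 + I*τ)‖^2 ≤ 128 * (1+‖τ‖^2)^(-(3/2:ℝ)/2) := by
  have hz := aux_zeta ε τ h0 h1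
  have hw : (1+τ^2)/16 ≤ ‖(1/2 - ε + I*τ : ℂ)‖^2 := by
    rw [← normSq_eq_norm_sq, normSq_apply]; simp
    nlinarith [sq_nonneg τ]
  have hv : (1+τ^2)/16 ≤ ‖(1/2 + I*τ : ℂ)‖^2 := by
    rw [← normSq_eq_norm_sq, normSq_apply]; simp
    nlinarith [sq_nonneg τ]
  have hT : 0 < 1 + τ^2 := by positivity
  have hK : (1+9*τ^2)^(1/4:ℝ) ≤ 3 * (1+τ^2)^(1/4:ℝ) := by
    calc _ ≤ (9*(1+τ^2))^(1/4:ℝ) := by gcongr; nlinarith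
      _ = 9^(1/4:ℝ) * (1+τ^2)^(1/4:ℝ) := Real.mul_rpow (by norm_num) hT.le
      _ ≤ _ := by
        gcongr
        calc (9:ℝ)^(1/4:ℝ) ≤ 9^(1/2:ℝ) :=
              Real.rpow_le_rpow_of_exponent_le (by norm_num) (by norm_num)
          _ = 3 := by
            rw [← Real.sqrt_eq_rpow, show (9:ℝ) = 3^2 by norm_num, Real.sqrt_sq (by norm_num)]
  have h1K : 1 ≤ (1+τ^2)^(1/4:ℝ) := Real.one_le_rpow (by nlinarith [sq_nonneg τ]) (by norm_num)
  have hpow : (1+‖τ‖^2)^(-(3/2:ℝ)/2) = (1+τ^2)^(1/4:ℝ) / (1+τ^2) := by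
    rw [Real.norm_eq_abs, sq_abs, ← Real.rpow_sub_one hT.ne']; norm_num
  rw [hpow]
  have hA : ‖riemannZeta (1/2 - ε + I*τ) /
            (riemannZeta (1/2 + ε + I*τ) * (1/2 - ε + I*τ))‖^2 ≤
            48 * ((1+τ^2)^(1/4:ℝ) / (1+τ^2)) := by
    rw [← div_div, norm_div, div_pow, norm_div, div_pow]
    have hq : ‖riemannZeta (1/2 - ε + I*τ)‖^2 / ‖riemannZeta (1/2 + ε + I*τ)‖^2 ≤
        3 * (1+τ^2)^(1/4:ℝ) :=
      (div_le_of_le_mul₀ (by positivity) (by positivity) hz).trans hK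
    calc _ ≤ (3 * (1+τ^2)^(1/4:ℝ)) / ((1+τ^2)/16) := by gcongr
      _ = _ := by field_simp; norm_num
  have hB : ‖(1 / (1/2 + I*τ) : ℂ)‖^2 ≤ 16 * ((1+τ^2)^(1/4:ℝ) / (1+τ^2)) := by
    rw [norm_div, norm_one, div_pow, one_pow]
    calc _ ≤ (1+τ^2)^(1/4:ℝ) / ((1+τ^2)/16) := by gcongr
      _ = _ := by field_simp
  have hs := norm_sub_le (riemannZeta (1/2 - ε + I*τ) /
            (riemannZeta (1/2 + ε + I*τ) * (1/2 - ε + I*τ))) (1 / (1/2 + I*τ))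
  generalize ‖riemannZeta (1/2 - ε + I*τ) /
            (riemannZeta (1/2 + ε + I*τ) * (1/2 - ε + I*τ))‖ = x at *
  generalize ‖(1 / (1/2 + I*τ) : ℂ)‖ = z at *
  calc _ ≤ (x+z)^2 := by gcongr
    _ ≤ 2*(x^2+z^2) := by nlinarith [sq_nonneg (x-z)]
    _ ≤ _ := by linarith

lemma aux_ne_one (c τ : ℝ) (hc : c ≠ 1) : ((c:ℂ) + I*τ) ≠ 1 := fun h => hc (by
  simpa using congrArg Complex.re h)

theorem mellin_side_L2_limit :
    Tendsto
      (fun ε : ℝ => eLpNorm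
        (fun τ : ℝ =>
          riemannZeta (1/2 - ε + I*τ) /
            (riemannZeta (1/2 + ε + I*τ) * (1/2 - ε + I*τ)) -
          1 / (1/2 + I*τ))
        2 volume)
      (nhdsWithin 0 (Set.Ioi 0)) (nhds 0) := by
  have hev : ∀ᶠ ε : ℝ in nhdsWithin 0 (Set.Ioi 0), 0 < ε ∧ ε ≤ 1/4 := by
    filter_upwards [Ioc_mem_nhdsGT (show (0:ℝ) < 1/4 by norm_num)] with ε h using h
  simp only [eLpNorm_eq_lintegral_rpow_enorm_toReal two_ne_zero ENNReal.ofNat_ne_top]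
  have key : Tendsto (fun ε : ℝ => ∫⁻ τ : ℝ, ‖riemannZeta (1/2 - ε + I*τ) /
            (riemannZeta (1/2 + ε + I*τ) * (1/2 - ε + I*τ)) -
          1 / (1/2 + I*τ)‖ₑ ^ (2:ENNReal).toReal) (nhdsWithin 0 (Set.Ioi 0))
          (nhds (∫⁻ _ : ℝ, 0)) := by
    refine tendsto_lintegral_filter_of_dominated_convergence
      (fun τ : ℝ => ENNReal.ofReal (128 * (1+‖τ‖^2)^(-(3/2:ℝ)/2))) ?_ ?_ ?_ ?_
    · filter_upwards [hev] with ε hε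
      have m1 : Measurable fun τ : ℝ => riemannZeta (1/2 - ε + I*τ) := by
        refine Continuous.measurable (continuous_iff_continuousAt.2 fun τ => ?_)
        have := (differentiableAt_riemannZeta
          (aux_ne_one (1/2-ε) τ (by linarith))).continuousAt
        push_cast at this
        exact ContinuousAt.comp (f := fun τ : ℝ => (1/2 - ε + I*τ : ℂ)) this (by fun_prop)
      have m2 : Measurable fun τ : ℝ => riemannZeta (1/2 + ε + I*τ) := by
        refine Continuous.measurable (continuous_iff_continuousAt.2 fun τ => ?_)
        have := (differentiableAt_riemannZeta
          (aux_ne_one (1/2+ε) τ (by linarith))).continuousAt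
        push_cast at this
        exact ContinuousAt.comp (f := fun τ : ℝ => (1/2 + ε + I*τ : ℂ)) this (by fun_prop)
      fun_prop
    · filter_upwards [hev] with ε hε
      refine Eventually.of_forall fun τ => ?_
      rw [← ofReal_norm, ENNReal.toReal_ofNat, ENNReal.ofReal_rpow_of_nonneg (norm_nonneg _)
        (by norm_num), Real.rpow_two]
      exact ENNReal.ofReal_le_ofReal (aux_bound ε τ hε.1 hε.2)
    · have := (integrable_rpow_neg_one_add_norm_sq (E := ℝ) (μ := volume) (r := 3/2)
        (by simp; norm_num)).const_mul 128
      exact this.lintegral_lt_top.ne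
    · filter_upwards [aux_ae] with τ hτ
      have hz : ContinuousAt riemannZeta (1/2 + I*τ) := by
        have := (differentiableAt_riemannZeta (aux_ne_one (1/2) τ (by norm_num))).continuousAt
        push_cast at this
        exact this
      have hv : (1/2 + I*τ : ℂ) ≠ 0 := fun h => by simpa using congrArg Complex.re h
      have t1 : Tendsto (fun ε : ℝ => (1/2 - ε + I*τ : ℂ)) (nhdsWithin 0 (Set.Ioi 0))
          (nhds (1/2 + I*τ)) := by
        have : Continuous (fun ε : ℝ => (1/2 - ε + I*τ : ℂ)) := by fun_prop
        simpa using (this.tendsto 0).mono_left nhdsWithin_le_nhds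
      have t2 : Tendsto (fun ε : ℝ => (1/2 + ε + I*τ : ℂ)) (nhdsWithin 0 (Set.Ioi 0))
          (nhds (1/2 + I*τ)) := by
        have : Continuous (fun ε : ℝ => (1/2 + ε + I*τ : ℂ)) := by fun_prop
        simpa using (this.tendsto 0).mono_left nhdsWithin_le_nhds
      have t3 := ((((hz.tendsto.comp t1).div ((hz.tendsto.comp t2).mul t1)
        (mul_ne_zero hτ hv)).sub_const (1 / (1/2 + I*τ))).enorm).ennrpow_const 2
      have e : riemannZeta (1/2 + I*τ) / (riemannZeta (1/2 + I*τ) * (1/2 + I*τ)) -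
          1 / (1/2 + I*τ) = 0 := by
        rw [← div_div, div_self hτ, sub_self]
      rw [e] at t3
      simpa using t3
  have := key.ennrpow_const (1 / (2:ENNReal).toReal)
  simpa using this
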